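/- If Θ < 1, Ω > 1 and Γ > 1, then f₁ ∈ Lip δ for δ = min( log α / log |I_min|, log γ / log |I_min| ), i.e. there exists C > 0 such that |f₁(x) − f₁(y)| ≤ C|x − y|^δ for all x, y ∈ [0,1]. -/

import Mathlib

/-- Minimum of `g i` over `i = 1, …, N`. -/
noncomputable def minOver (N : ℕ) (g : ℕ → ℝ) : ℝ := sInf (g '' Set.Icc 1 N)

/-- Maximum of `g i` over `i = 1, …, N`. -/
noncomputable def maxOver (N : ℕ) (g : ℕ → ℝ) : ℝ := sSup (g '' Set.Icc 1 N)

open Set Filter Topology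

lemma exists_eq_maxOver {N : ℕ} (hN : 1 ≤ N) (g : ℕ → ℝ) : ∃ i ∈ Set.Icc 1 N, g i = maxOver N g :=
  ((Set.nonempty_Icc.2 hN).image g).csSup_mem ((Set.finite_Icc 1 N).image g)

lemma exists_eq_minOver {N : ℕ} (hN : 1 ≤ N) (g : ℕ → ℝ) : ∃ i ∈ Set.Icc 1 N, g i = minOver N g :=
  ((Set.nonempty_Icc.2 hN).image g).csInf_mem ((Set.finite_Icc 1 N).image g)

lemma le_maxOver {N i : ℕ} (hi : i ∈ Set.Icc 1 N) (g : ℕ → ℝ) : g i ≤ maxOver N g :=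
  le_csSup ((Set.finite_Icc 1 N).image g).bddAbove (Set.mem_image_of_mem g hi)

lemma minOver_le {N i : ℕ} (hi : i ∈ Set.Icc 1 N) (g : ℕ → ℝ) : minOver N g ≤ g i :=
  csInf_le ((Set.finite_Icc 1 N).image g).bddBelow (Set.mem_image_of_mem g hi)

lemma partition_length_pos {N i : ℕ} {x : ℕ → ℝ} (hxmono : ∀ i < N, x i < x (i + 1))
    (hi : i ∈ Set.Icc 1 N) : 0 < x i - x (i - 1) := by
  have := hxmono (i - 1) (by have := hi.1; have := hi.2; omega)
  rw [Nat.sub_add_cancel hi.1] at this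
  linarith

lemma partition_length_lt_one {N i : ℕ} {x : ℕ → ℝ} (hN : 2 ≤ N) (hx0 : x 0 = 0) (hxN : x N = 1)
    (hxmono : ∀ i < N, x i < x (i + 1)) (hi : i ∈ Set.Icc 1 N) : x i - x (i - 1) < 1 := by
  have hmono : ∀ j ≤ N, ∀ i ≤ j, x i ≤ x j := by
    intro j hj i hij
    induction j, hij using Nat.le_induction with
    | base => exact le_rfl
    | succ j hij ih => exact (ih (by omega)).trans (hxmono j (by omega)).le
  obtain ⟨hi1, hi2⟩ := hi
  rcases Nat.lt_or_ge 1 i with h1 | h1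
  · have h3 := hmono (i - 1) (by omega) 1 (by omega)
    have h4 := hmono N le_rfl i hi2
    have h5 := hxmono 0 (by omega)
    simp only [zero_add] at h5
    linarith
  · obtain rfl : i = 1 := by omega
    have h3 := hmono N le_rfl 2 hN
    have h4 := hxmono 1 (by omega)
    simp only [Nat.sub_self, Nat.reduceAdd] at *
    linarith

/-- A Hölder bound for all pairs in `P`, when each pair either satisfies such a bound already or is
the contracted image of another pair in `P`. -/
lemma exists_holder_of_contracted_pairs {S : Set ℕ} {P : ℝ → ℝ → Prop} {g : ℝ → ℝ} {a ℓ : ℕ → ℝ}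
    {r δ η M A K : ℝ} (hr0 : 0 < r) (hr1 : r < 1) (hℓ : ∀ i ∈ S, 0 < ℓ i ∧ ℓ i ≤ r)
    (hδη : δ ≤ η) (hδ : 0 < δ) (hA : 0 ≤ A)
    (hC : ∀ᶠ C in atTop, ∀ i ∈ S, ∀ d ∈ Set.Icc (0 : ℝ) 1,
      |a i| * (C * d ^ δ - A * d ^ η) + M * d ^ η ≤ C * (ℓ i * d) ^ δ - A * (ℓ i * d) ^ η)
    (hP : ∀ s t, P s t → |s - t| ≤ 1)
    (hrec : ∀ s t, P s t → |g s - g t| ≤ K * |s - t| ^ δ ∨ ∃ i ∈ S, ∃ s' t', P s' t' ∧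
      |s - t| = ℓ i * |s' - t'| ∧ |g s - g t| ≤ |a i| * |g s' - g t'| + M * |s' - t'| ^ η) :
    ∃ C > 0, ∀ s t, P s t → |g s - g t| ≤ C * |s - t| ^ δ := by
  obtain ⟨C, hC, hCK, hC0⟩ :=
    (hC.and ((eventually_ge_atTop (K + A)).and (eventually_gt_atTop 0))).exists
  refine ⟨C, hC0, ?_⟩
  have key : ∀ n : ℕ, ∀ s t, P s t → r ^ n ≤ |s - t| →
      |g s - g t| ≤ C * |s - t| ^ δ - A * |s - t| ^ η := by
    have base : ∀ s t, P s t → |g s - g t| ≤ K * |s - t| ^ δ →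
        |g s - g t| ≤ C * |s - t| ^ δ - A * |s - t| ^ η := by
      intro s t hst h
      have h1 : |s - t| ^ η ≤ |s - t| ^ δ :=
        Real.rpow_le_rpow_of_exponent_ge' (abs_nonneg _) (hP s t hst) hδ.le hδη
      have h2 : 0 ≤ |s - t| ^ δ := by positivity
      nlinarith [mul_le_mul_of_nonneg_left h1 hA, mul_le_mul_of_nonneg_right hCK h2]
    have step : ∀ s t, P s t → ∀ i ∈ S, ∀ s' t', P s' t' → |s - t| = ℓ i * |s' - t'| →
        |g s - g t| ≤ |a i| * |g s' - g t'| + M * |s' - t'| ^ η →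
        |g s' - g t'| ≤ C * |s' - t'| ^ δ - A * |s' - t'| ^ η →
        |g s - g t| ≤ C * |s - t| ^ δ - A * |s - t| ^ η := by
      intro s t hst i hi s' t' hst' hd hg ih
      have h1 := hC i hi |s' - t'| ⟨abs_nonneg _, hP _ _ hst'⟩
      rw [hd]
      have := mul_le_mul_of_nonneg_left ih (abs_nonneg (a i))
      linarith
    intro n
    induction n with
    | zero =>
      intro s t hst hn
      rcases hrec s t hst with h | ⟨i, hi, s', t', hst', hd, -⟩
      · exact base s t hst h
      · exfalso
        have := hP _ _ hst'
        have := hℓ i hi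
        rw [pow_zero, hd] at hn
        nlinarith
    | succ n ih =>
      intro s t hst hn
      rcases hrec s t hst with h | ⟨i, hi, s', t', hst', hd, hg⟩
      · exact base s t hst h
      · refine step s t hst i hi s' t' hst' hd hg (ih s' t' hst' ?_)
        have h1 : r ^ n * r ≤ r * |s' - t'| := by
          rw [← pow_succ]
          refine hn.trans (hd.trans_le ?_)
          gcongr
          exact (hℓ i hi).2
        nlinarith
  intro s t hst
  rcases eq_or_ne s t with rfl | hne
  · simp [Real.zero_rpow hδ.ne']
  · obtain ⟨n, hn⟩ := exists_pow_lt_of_lt_one (abs_pos.2 (sub_ne_zero.2 hne)) hr1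
    have h1 := key n s t hst hn.le
    have h2 : 0 ≤ A * |s - t| ^ η := by positivity
    linarith

/-- Hölder continuity of a continuous solution of `g (L_i t) = a_i g t + h_i t` whenever
`d ↦ C d ^ δ - A d ^ η` is a majorant compatible with the recursion for all large `C`. -/
lemma exists_holder_of_selfAffine {N : ℕ} (hN : 2 ≤ N) {x : ℕ → ℝ} (hx0 : x 0 = 0) (hxN : x N = 1)
    (hxmono : ∀ i < N, x i < x (i + 1)) {a : ℕ → ℝ} {h : ℕ → ℝ → ℝ} {g : ℝ → ℝ}
    {δ η M A : ℝ} (hδη : δ ≤ η) (hδ : 0 < δ) (hA : 0 ≤ A)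
    (hC : ∀ᶠ C in atTop, ∀ i ∈ Set.Icc 1 N, ∀ d ∈ Set.Icc (0 : ℝ) 1,
      |a i| * (C * d ^ δ - A * d ^ η) + M * d ^ η ≤
        C * ((x i - x (i - 1)) * d) ^ δ - A * ((x i - x (i - 1)) * d) ^ η)
    (hh : ∀ i ∈ Set.Icc 1 N, ∀ s ∈ Set.Icc (0 : ℝ) 1, ∀ t ∈ Set.Icc (0 : ℝ) 1,
      |h i s - h i t| ≤ M * |s - t| ^ η)
    (hg : ContinuousOn g (Set.Icc 0 1))
    (heq : ∀ i ∈ Set.Icc 1 N, ∀ t ∈ Set.Icc (0 : ℝ) 1,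
      g ((x i - x (i - 1)) * t + x (i - 1)) = a i * g t + h i t) :
    ∃ C > 0, ∀ s ∈ Set.Icc (0 : ℝ) 1, ∀ t ∈ Set.Icc (0 : ℝ) 1, |g s - g t| ≤ C * |s - t| ^ δ := by
  have hpos : ∀ i ∈ Set.Icc 1 N, 0 < x i - x (i - 1) := fun i hi => partition_length_pos hxmono hi
  have hlt : ∀ i ∈ Set.Icc 1 N, x i - x (i - 1) < 1 :=
    fun i hi => partition_length_lt_one hN hx0 hxN hxmono hi
  obtain ⟨m, hm, hm0⟩ : ∃ m, (∀ i ∈ Set.Icc 1 N, m ≤ x i - x (i - 1)) ∧ 0 < m := by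
    have : ∀ᶠ m in 𝓝[>] (0 : ℝ), ∀ i ∈ Set.Icc 1 N, m ≤ x i - x (i - 1) := by
      rw [eventually_all_finite (Set.finite_Icc 1 N)]
      intro i hi
      filter_upwards [Ioo_mem_nhdsGT (hpos i hi)] with m hm using hm.2.le
    exact (this.and self_mem_nhdsWithin).exists
  obtain ⟨r, hr, hr0, hr1⟩ : ∃ r, (∀ i ∈ Set.Icc 1 N, x i - x (i - 1) ≤ r) ∧ 0 < r ∧ r < 1 := by
    have : ∀ᶠ r in 𝓝[<] (1 : ℝ), ∀ i ∈ Set.Icc 1 N, x i - x (i - 1) ≤ r := by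
      rw [eventually_all_finite (Set.finite_Icc 1 N)]
      intro i hi
      filter_upwards [Ioo_mem_nhdsLT (hlt i hi)] with m hm using hm.1.le
    exact (this.and (Ioo_mem_nhdsLT zero_lt_one)).exists
  obtain ⟨B, hB⟩ : ∃ B, ∀ s ∈ Set.Icc (0 : ℝ) 1, |g s| ≤ B :=
    isCompact_Icc.exists_bound_of_continuousOn hg
  have hfar : ∀ s ∈ Set.Icc (0 : ℝ) 1, ∀ t ∈ Set.Icc (0 : ℝ) 1, m ≤ t - s →
      |g s - g t| ≤ 2 * B / m ^ δ * |s - t| ^ δ := by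
    intro s hs t ht hst
    have h1 : |g s - g t| ≤ 2 * B := by
      have := abs_sub (g s) (g t)
      linarith [hB s hs, hB t ht]
    have h2 : m ^ δ ≤ |s - t| ^ δ := by
      refine Real.rpow_le_rpow hm0.le ?_ hδ.le
      rw [abs_sub_comm]
      exact hst.trans (le_abs_self _)
    have hmδ : 0 < m ^ δ := by positivity
    rw [div_mul_eq_mul_div, le_div_iff₀ hmδ]
    exact mul_le_mul h1 h2 hmδ.le ((abs_nonneg _).trans h1)
  have hcell : ∀ i ∈ Set.Icc 1 N, ∀ s t, x (i - 1) ≤ s → s ≤ t → t ≤ x i → ∃ s' t',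
      s = (x i - x (i - 1)) * s' + x (i - 1) ∧ t = (x i - x (i - 1)) * t' + x (i - 1) ∧
      0 ≤ s' ∧ s' ≤ t' ∧ t' ≤ 1 ∧ |s - t| = (x i - x (i - 1)) * |s' - t'| ∧
      |g s - g t| ≤ |a i| * |g s' - g t'| + M * |s' - t'| ^ η := by
    intro i hi s t hs hst ht
    have hℓ := hpos i hi
    obtain ⟨s', hs'⟩ : ∃ s', s = (x i - x (i - 1)) * s' + x (i - 1) :=
      ⟨(s - x (i - 1)) / (x i - x (i - 1)), by field_simp; ring⟩
    obtain ⟨t', ht'⟩ : ∃ t', t = (x i - x (i - 1)) * t' + x (i - 1) :=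
      ⟨(t - x (i - 1)) / (x i - x (i - 1)), by field_simp; ring⟩
    have h0 : 0 ≤ s' := by
      by_contra! hc
      nlinarith
    have h1 : s' ≤ t' := by
      by_contra! hc
      nlinarith
    have h2 : t' ≤ 1 := by
      by_contra! hc
      nlinarith
    refine ⟨s', t', hs', ht', h0, h1, h2, ?_, ?_⟩
    · rw [hs', ht', add_sub_add_right_eq_sub, ← mul_sub, abs_mul, abs_of_pos hℓ]
    · have hs1 : s' ∈ Set.Icc (0 : ℝ) 1 := ⟨h0, h1.trans h2⟩
      have ht1 : t' ∈ Set.Icc (0 : ℝ) 1 := ⟨h0.trans h1, h2⟩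
      rw [hs', ht', heq i hi s' hs1, heq i hi t' ht1, ← abs_mul]
      calc |a i * g s' + h i s' - (a i * g t' + h i t')|
          = |a i * (g s' - g t') + (h i s' - h i t')| := by ring_nf
        _ ≤ |a i * (g s' - g t')| + |h i s' - h i t'| := abs_add_le _ _
        _ ≤ _ := by gcongr; exact hh i hi s' hs1 t' ht1
  have hNmem : N ∈ Set.Icc 1 N := ⟨by omega, le_rfl⟩
  have h1mem : 1 ∈ Set.Icc 1 N := ⟨le_rfl, by omega⟩
  have hdist : ∀ s t : ℝ, 0 ≤ s → s ≤ t → t ≤ 1 → |s - t| ≤ 1 := by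
    intro s t h0 h1 h2
    rw [abs_le]
    constructor <;> linarith
  have hℓ : ∀ i ∈ Set.Icc 1 N, 0 < x i - x (i - 1) ∧ x i - x (i - 1) ≤ r :=
    fun i hi => ⟨hpos i hi, hr i hi⟩
  obtain ⟨CR, hCR0, hCR⟩ : ∃ C > 0, ∀ s t, (0 ≤ s ∧ s ≤ t ∧ t = 1) →
      |g s - g t| ≤ C * |s - t| ^ δ := by
    refine exists_holder_of_contracted_pairs hr0 hr1 hℓ hδη hδ hA hC
      (fun s t hst => hdist s t hst.1 hst.2.1 hst.2.2.le) (K := 2 * B / m ^ δ) ?_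
    rintro s t ⟨h0, h1, rfl⟩
    rcases le_total (x (N - 1)) s with hs | hs
    · right
      obtain ⟨s', t', -, ht', h0', h1', -, hd, hg'⟩ := hcell N hNmem s 1 hs h1 hxN.ge
      refine ⟨N, hNmem, s', t', ⟨h0', h1', ?_⟩, hd, hg'⟩
      have := hpos N hNmem
      refine mul_left_cancel₀ this.ne' ?_
      linarith
    · left
      refine hfar s ⟨h0, h1⟩ 1 (by simp) ?_
      linarith [hm N hNmem]
  obtain ⟨CL, hCL0, hCL⟩ : ∃ C > 0, ∀ s t, (s = 0 ∧ s ≤ t ∧ t ≤ 1) →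
      |g s - g t| ≤ C * |s - t| ^ δ := by
    refine exists_holder_of_contracted_pairs hr0 hr1 hℓ hδη hδ hA hC
      (fun s t hst => hdist s t hst.1.ge hst.2.1 hst.2.2) (K := 2 * B / m ^ δ) ?_
    rintro s t ⟨rfl, h1, h2⟩
    rcases le_total t (x 1) with ht | ht
    · right
      obtain ⟨s', t', hs', -, h0', h1', h2', hd, hg'⟩ := hcell 1 h1mem 0 t hx0.le h1 ht
      refine ⟨1, h1mem, s', t', ⟨?_, h1', h2'⟩, hd, hg'⟩
      have := hpos 1 h1mem
      simp only [Nat.sub_self, hx0] at hs' this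
      refine mul_left_cancel₀ this.ne' ?_
      linarith
    · left
      refine hfar 0 (by simp) t ⟨h1, h2⟩ ?_
      have := hm 1 h1mem
      simp only [Nat.sub_self, hx0] at this
      linarith
  have hM0 : 0 ≤ M := by
    have := (abs_nonneg _).trans (hh 1 h1mem 0 (by simp) 1 (by simp))
    simpa using this
  have hright : ∀ i ∈ Set.Icc 1 N, ∃ K, ∀ s, x (i - 1) ≤ s → s ≤ x i →
      |g s - g (x i)| ≤ K * |s - x i| ^ δ := by
    intro i hi
    refine ⟨(|a i| * CR + M) / (x i - x (i - 1)) ^ δ, fun s hs hs' => ?_⟩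
    obtain ⟨u, v, hu, hv, h0, h1, h2, hd, hg'⟩ := hcell i hi s (x i) hs hs' le_rfl
    have hpi := hpos i hi
    have hv1 : v = 1 := by
      refine mul_left_cancel₀ hpi.ne' ?_
      linarith
    have h3 := hCR u v ⟨h0, h1, hv1⟩
    have h4 : |u - v| ^ η ≤ |u - v| ^ δ :=
      Real.rpow_le_rpow_of_exponent_ge' (abs_nonneg _) (hdist u v h0 h1 h2) hδ.le hδη
    have h5 : 0 < (x i - x (i - 1)) ^ δ := by positivity
    rw [hd, Real.mul_rpow hpi.le (abs_nonneg _), ← mul_assoc, div_mul_cancel₀ _ h5.ne']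
    nlinarith [mul_le_mul_of_nonneg_left h3 (abs_nonneg (a i)), mul_le_mul_of_nonneg_left h4 hM0]
  have hleft : ∀ i ∈ Set.Icc 1 N, ∃ K, ∀ t, x (i - 1) ≤ t → t ≤ x i →
      |g (x (i - 1)) - g t| ≤ K * |x (i - 1) - t| ^ δ := by
    intro i hi
    refine ⟨(|a i| * CL + M) / (x i - x (i - 1)) ^ δ, fun s hs hs' => ?_⟩
    obtain ⟨u, v, hu, hv, h0, h1, h2, hd, hg'⟩ := hcell i hi (x (i - 1)) s le_rfl hs hs'
    have hpi := hpos i hi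
    have hu0 : u = 0 := by
      refine mul_left_cancel₀ hpi.ne' ?_
      linarith
    have h3 := hCL u v ⟨hu0, h1, h2⟩
    have h4 : |u - v| ^ η ≤ |u - v| ^ δ :=
      Real.rpow_le_rpow_of_exponent_ge' (abs_nonneg _) (hdist u v h0 h1 h2) hδ.le hδη
    have h5 : 0 < (x i - x (i - 1)) ^ δ := by positivity
    rw [hd, Real.mul_rpow hpi.le (abs_nonneg _), ← mul_assoc, div_mul_cancel₀ _ h5.ne']
    nlinarith [mul_le_mul_of_nonneg_left h3 (abs_nonneg (a i)), mul_le_mul_of_nonneg_left h4 hM0]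
  obtain ⟨K, hK, hKB, hK0⟩ : ∃ K, (∀ i ∈ Set.Icc 1 N, (∀ s, x (i - 1) ≤ s → s ≤ x i →
      |g s - g (x i)| ≤ K * |s - x i| ^ δ) ∧ ∀ t, x (i - 1) ≤ t → t ≤ x i →
      |g (x (i - 1)) - g t| ≤ K * |x (i - 1) - t| ^ δ) ∧ 2 * B / m ^ δ ≤ 2 * K ∧ 0 ≤ K := by
    have : ∀ᶠ K in atTop, ∀ i ∈ Set.Icc 1 N, (∀ s, x (i - 1) ≤ s → s ≤ x i →
        |g s - g (x i)| ≤ K * |s - x i| ^ δ) ∧ ∀ t, x (i - 1) ≤ t → t ≤ x i →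
        |g (x (i - 1)) - g t| ≤ K * |x (i - 1) - t| ^ δ := by
      rw [eventually_all_finite (Set.finite_Icc 1 N)]
      intro i hi
      obtain ⟨K₁, h₁⟩ := hright i hi
      obtain ⟨K₂, h₂⟩ := hleft i hi
      filter_upwards [eventually_ge_atTop K₁, eventually_ge_atTop K₂] with K hK₁ hK₂
      refine ⟨fun s hs hs' => (h₁ s hs hs').trans ?_, fun s hs hs' => (h₂ s hs hs').trans ?_⟩ <;>
        gcongr
    obtain ⟨K, h1, h2, h3⟩ := (this.and ((eventually_ge_atTop (2 * B / m ^ δ / 2)).and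
      (eventually_ge_atTop 0))).exists
    exact ⟨K, h1, by linarith, h3⟩
  obtain ⟨C, hC0, hCall⟩ : ∃ C > 0, ∀ s t, (0 ≤ s ∧ s ≤ t ∧ t ≤ 1) →
      |g s - g t| ≤ C * |s - t| ^ δ := by
    refine exists_holder_of_contracted_pairs hr0 hr1 hℓ hδη hδ hA hC
      (fun s t hst => hdist s t hst.1 hst.2.1 hst.2.2) (K := 2 * K) ?_
    rintro s t ⟨h0, h1, h2⟩
    obtain ⟨i, hi, his, hsi⟩ : ∃ i ∈ Set.Icc 1 N, x (i - 1) ≤ s ∧ s ≤ x i := by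
      classical
      have hex : ∃ i, 1 ≤ i ∧ s ≤ x i := ⟨N, by omega, by linarith⟩
      obtain ⟨hi1, hi2⟩ := Nat.find_spec hex
      refine ⟨Nat.find hex, ⟨hi1, Nat.find_min' hex ⟨by omega, by linarith⟩⟩, ?_, hi2⟩
      by_contra! hc
      refine Nat.find_min hex (m := Nat.find hex - 1) (by omega) ⟨?_, hc.le⟩
      by_contra! h3
      have h4 : Nat.find hex - 1 = 0 := by omega
      rw [h4, hx0] at hc
      linarith
    rcases le_total t (x i) with hti | hti
    · right
      obtain ⟨s', t', -, -, h0', h1', h2', hd, hg'⟩ := hcell i hi s t his h1 hti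
      exact ⟨i, hi, s', t', ⟨h0', h1', h2'⟩, hd, hg'⟩
    left
    rcases hi.2.eq_or_lt with rfl | hiN
    · obtain rfl : t = x i := by linarith
      refine ((hK i hi).1 s his hsi).trans ?_
      gcongr
      linarith
    have hi' : i + 1 ∈ Set.Icc 1 N := ⟨by omega, hiN⟩
    rcases le_total t (x (i + 1)) with htj | htj
    · have h3 := (hK i hi).1 s his hsi
      have h4 := (hK (i + 1) hi').2 t hti htj
      rw [Nat.add_sub_cancel] at h4
      have h5 : |s - x i| ^ δ ≤ |s - t| ^ δ := by
        refine Real.rpow_le_rpow (abs_nonneg _) ?_ hδ.le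
        rw [abs_of_nonpos (by linarith), abs_of_nonpos (by linarith)]
        linarith
      have h6 : |x i - t| ^ δ ≤ |s - t| ^ δ := by
        refine Real.rpow_le_rpow (abs_nonneg _) ?_ hδ.le
        rw [abs_of_nonpos (by linarith), abs_of_nonpos (by linarith)]
        linarith
      linarith [abs_sub_le (g s) (g (x i)) (g t), mul_le_mul_of_nonneg_left h5 hK0,
        mul_le_mul_of_nonneg_left h6 hK0]
    · have h3 := hm (i + 1) hi'
      rw [Nat.add_sub_cancel] at h3
      refine (hfar s ⟨h0, h1.trans h2⟩ t ⟨h0.trans h1, h2⟩ (by linarith)).trans ?_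
      gcongr
  refine ⟨C, hC0, fun s hs t ht => ?_⟩
  rcases le_total s t with hst | hst
  · exact hCall s t ⟨hs.1, hst, ht.2⟩
  · rw [abs_sub_comm, abs_sub_comm s]
    exact hCall t s ⟨ht.1, hst, hs.2⟩

lemma eventually_majorant_of_le {S : Set ℕ} (hS : S.Finite) {a ℓ : ℕ → ℝ} {δ η M : ℝ}
    (hδ : 0 < δ) (hδη : δ < η) (hℓ : ∀ i ∈ S, 0 < ℓ i ∧ ℓ i < 1) (ha : ∀ i ∈ S, |a i| ≤ ℓ i ^ δ) :
    ∃ A ≥ 0, ∀ᶠ C in atTop, ∀ i ∈ S, ∀ d ∈ Set.Icc (0 : ℝ) 1,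
      |a i| * (C * d ^ δ - A * d ^ η) + M * d ^ η ≤ C * (ℓ i * d) ^ δ - A * (ℓ i * d) ^ η := by
  obtain ⟨A, hAM, hA⟩ : ∃ A, (∀ i ∈ S, M ≤ A * (ℓ i ^ δ - ℓ i ^ η)) ∧ 0 ≤ A := by
    have : ∀ᶠ A in atTop, ∀ i ∈ S, M ≤ A * (ℓ i ^ δ - ℓ i ^ η) := by
      rw [eventually_all_finite hS]
      intro i hi
      have h1 : 0 < ℓ i ^ δ - ℓ i ^ η :=
        sub_pos.2 (Real.rpow_lt_rpow_of_exponent_gt (hℓ i hi).1 (hℓ i hi).2 hδη)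
      filter_upwards [eventually_ge_atTop (M / (ℓ i ^ δ - ℓ i ^ η))] with A hA
      rwa [div_le_iff₀ h1] at hA
    exact (this.and (eventually_ge_atTop 0)).exists
  refine ⟨A, hA, ?_⟩
  filter_upwards [eventually_ge_atTop A] with C hC i hi d hd
  have h1 : d ^ η ≤ d ^ δ := Real.rpow_le_rpow_of_exponent_ge' hd.1 hd.2 hδ.le hδη.le
  have h2 : 0 ≤ d ^ η := Real.rpow_nonneg hd.1 _
  have h3 : 0 ≤ C * d ^ δ - A * d ^ η :=
    sub_nonneg.2 (mul_le_mul hC h1 h2 (hA.trans hC))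
  rw [Real.mul_rpow (hℓ i hi).1.le hd.1, Real.mul_rpow (hℓ i hi).1.le hd.1]
  linarith [mul_le_mul_of_nonneg_right (ha i hi) h3, mul_le_mul_of_nonneg_right (hAM i hi) h2]

lemma eventually_majorant_of_lt {S : Set ℕ} (hS : S.Finite) {a ℓ : ℕ → ℝ} {δ M : ℝ}
    (hℓ : ∀ i ∈ S, 0 < ℓ i) (ha : ∀ i ∈ S, |a i| < ℓ i ^ δ) :
    ∀ᶠ C in atTop, ∀ i ∈ S, ∀ d ∈ Set.Icc (0 : ℝ) 1,
      |a i| * (C * d ^ δ - 0 * d ^ δ) + M * d ^ δ ≤ C * (ℓ i * d) ^ δ - 0 * (ℓ i * d) ^ δ := by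
  rw [eventually_all_finite hS]
  intro i hi
  filter_upwards [eventually_ge_atTop (M / (ℓ i ^ δ - |a i|))] with C hC d hd
  rw [div_le_iff₀ (sub_pos.2 (ha i hi))] at hC
  rw [Real.mul_rpow (hℓ i hi).le hd.1]
  have h1 : 0 ≤ d ^ δ := Real.rpow_nonneg hd.1 _
  nlinarith [mul_le_mul_of_nonneg_right hC h1]

/-- A uniform constant and exponent for finitely many Hölder functions on the unit interval. -/
lemma exists_uniform_holder {S : Set ℕ} (hS : S.Finite) {h : ℕ → ℝ → ℝ} {e : ℕ → ℝ} {κ : ℝ}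
    (hκ : 0 ≤ κ) (he : ∀ i ∈ S, κ ≤ e i)
    (hh : ∀ i ∈ S, ∃ M > 0, ∀ s ∈ Set.Icc (0 : ℝ) 1, ∀ t ∈ Set.Icc (0 : ℝ) 1,
      |h i s - h i t| ≤ M * |s - t| ^ e i) :
    ∃ M ≥ 0, ∀ i ∈ S, ∀ s ∈ Set.Icc (0 : ℝ) 1, ∀ t ∈ Set.Icc (0 : ℝ) 1,
      |h i s - h i t| ≤ M * |s - t| ^ κ := by
  have : ∀ᶠ M in atTop, ∀ i ∈ S, ∀ s ∈ Set.Icc (0 : ℝ) 1, ∀ t ∈ Set.Icc (0 : ℝ) 1,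
      |h i s - h i t| ≤ M * |s - t| ^ κ := by
    rw [eventually_all_finite hS]
    intro i hi
    obtain ⟨M₀, hM₀, h₀⟩ := hh i hi
    filter_upwards [eventually_ge_atTop M₀] with M hM s hs t ht
    refine (h₀ s hs t ht).trans (mul_le_mul hM ?_ (by positivity) (hM₀.le.trans hM))
    refine Real.rpow_le_rpow_of_exponent_ge' (abs_nonneg _) ?_ hκ (he i hi)
    rw [abs_le]
    constructor <;> linarith [hs.1, hs.2, ht.1, ht.2]
  exact ((eventually_ge_atTop 0).and this).exists

/-- If some ratio `|c i| / ℓ i ^ κ` exceeds one, the exponent `log c / log ℓ_min` is positive,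
smaller than `κ`, and dominates every coefficient. -/
lemma critical_exponent {N : ℕ} (hN : 1 ≤ N) {c ℓ : ℕ → ℝ} {κ : ℝ} (hκ : 0 < κ)
    (hℓ : ∀ i ∈ Set.Icc 1 N, 0 < ℓ i) (hc : ∀ i ∈ Set.Icc 1 N, |c i| < 1)
    (hm1 : minOver N ℓ < 1) (h : 1 < maxOver N (fun i => |c i| / ℓ i ^ κ)) :
    0 < Real.log (maxOver N (fun i => |c i|)) / Real.log (minOver N ℓ) ∧
    Real.log (maxOver N (fun i => |c i|)) / Real.log (minOver N ℓ) < κ ∧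
    ∀ i ∈ Set.Icc 1 N,
      |c i| ≤ ℓ i ^ (Real.log (maxOver N (fun i => |c i|)) / Real.log (minOver N ℓ)) := by
  obtain ⟨j, hj, hjm⟩ := exists_eq_minOver hN ℓ
  have hm0 : 0 < minOver N ℓ := hjm ▸ hℓ j hj
  obtain ⟨k, hk, hkm⟩ := exists_eq_maxOver hN (fun i => |c i|)
  have hc1 : maxOver N (fun i => |c i|) < 1 := hkm ▸ hc k hk
  obtain ⟨i, hi, him⟩ := exists_eq_maxOver hN (fun i => |c i| / ℓ i ^ κ)
  have hmc : minOver N ℓ ^ κ < maxOver N (fun i => |c i|) := by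
    have h1 := Real.rpow_pos_of_pos (hℓ i hi) κ
    rw [← him, one_lt_div h1] at h
    exact ((Real.rpow_le_rpow hm0.le (minOver_le hi ℓ) hκ.le).trans_lt h).trans_le
      (le_maxOver hi (fun i => |c i|))
  have hc0 := (Real.rpow_pos_of_pos hm0 κ).trans hmc
  have hlm := Real.log_neg hm0 hm1
  have hpos := div_pos_of_neg_of_neg (Real.log_neg hc0 hc1) hlm
  refine ⟨hpos, ?_, fun n hn => ?_⟩
  · rw [div_lt_iff_of_neg hlm, ← Real.log_rpow hm0]
    exact Real.log_lt_log (by positivity) hmc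
  · calc |c n| ≤ maxOver N (fun i => |c i|) := le_maxOver hn (fun i => |c i|)
      _ = minOver N ℓ ^ Real.logb (minOver N ℓ) (maxOver N (fun i => |c i|)) :=
        (Real.rpow_logb hm0 hm1.ne hc0).symm
      _ ≤ _ := Real.rpow_le_rpow hm0.le (minOver_le hn ℓ) hpos.le

/-- If `Θ < 1`, `Ω > 1` and `Γ > 1`, then `f₁ ∈ Lip δ` with `δ = min (log α / log |I_min|, log γ / log |I_min|)`. -/
theorem chfif_theta_lt_one_omega_gt_one_gamma_gt_one
    (N : ℕ) (hN : 2 ≤ N)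
    (x : ℕ → ℝ) (hx0 : x 0 = 0) (hxN : x N = 1)
    (hxmono : ∀ i < N, x i < x (i + 1))
    (α β γ : ℕ → ℝ)
    (hα : ∀ i ∈ Set.Icc 1 N, |α i| < 1)
    (hβγ : ∀ i ∈ Set.Icc 1 N, |β i| + |γ i| < 1)
    (lam mu : ℕ → ℝ)
    (hlam : ∀ i ∈ Set.Icc 1 N, lam i ∈ Set.Ioc (0 : ℝ) 1)
    (hmu : ∀ i ∈ Set.Icc 1 N, mu i ∈ Set.Ioc (0 : ℝ) 1)
    (p q : ℕ → ℝ → ℝ)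
    (hp : ∀ i ∈ Set.Icc 1 N, ∃ M > 0, ∀ s ∈ Set.Icc (0 : ℝ) 1, ∀ t ∈ Set.Icc (0 : ℝ) 1,
      |p i s - p i t| ≤ M * |s - t| ^ lam i)
    (hq : ∀ i ∈ Set.Icc 1 N, ∃ M > 0, ∀ s ∈ Set.Icc (0 : ℝ) 1, ∀ t ∈ Set.Icc (0 : ℝ) 1,
      |q i s - q i t| ≤ M * |s - t| ^ mu i)
    (f₁ f₂ : ℝ → ℝ)
    (hf₁c : ContinuousOn f₁ (Set.Icc 0 1)) (hf₂c : ContinuousOn f₂ (Set.Icc 0 1))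
    (heq₁ : ∀ i ∈ Set.Icc 1 N, ∀ t ∈ Set.Icc (0 : ℝ) 1,
      f₁ ((x i - x (i - 1)) * t + x (i - 1)) = α i * f₁ t + β i * f₂ t + p i t)
    (heq₂ : ∀ i ∈ Set.Icc 1 N, ∀ t ∈ Set.Icc (0 : ℝ) 1,
      f₂ ((x i - x (i - 1)) * t + x (i - 1)) = γ i * f₂ t + q i t)
    (hΘ : maxOver N (fun i => |α i| / (x i - x (i - 1)) ^ minOver N mu) < 1)
    (hΩ : 1 < maxOver N (fun i => |α i| / (x i - x (i - 1)) ^ minOver N lam))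
    (hΓ : 1 < maxOver N (fun i => |γ i| / (x i - x (i - 1)) ^ minOver N mu))
    :
    ∃ C > 0, ∀ s ∈ Set.Icc (0 : ℝ) 1, ∀ t ∈ Set.Icc (0 : ℝ) 1,
      |f₁ s - f₁ t| ≤ C * |s - t| ^ (min (Real.log (maxOver N (fun i => |α i|)) / Real.log (minOver N (fun i => x i - x (i - 1)))) (Real.log (maxOver N (fun i => |γ i|)) / Real.log (minOver N (fun i => x i - x (i - 1))))) := by
  have hN1 : 1 ≤ N := by omega
  have hfin := Set.finite_Icc 1 N
  have hℓ0 : ∀ i ∈ Set.Icc 1 N, 0 < x i - x (i - 1) := fun i hi => partition_length_pos hxmono hi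
  have hℓ1 : ∀ i ∈ Set.Icc 1 N, x i - x (i - 1) < 1 :=
    fun i hi => partition_length_lt_one hN hx0 hxN hxmono hi
  have hγ : ∀ i ∈ Set.Icc 1 N, |γ i| < 1 := fun i hi => by
    linarith [hβγ i hi, abs_nonneg (β i)]
  have hlam0 : 0 < minOver N lam := by
    obtain ⟨i, hi, him⟩ := exists_eq_minOver hN1 lam
    exact him ▸ (hlam i hi).1
  have hmu0 : 0 < minOver N mu := by
    obtain ⟨i, hi, him⟩ := exists_eq_minOver hN1 mu
    exact him ▸ (hmu i hi).1
  have hm1 : minOver N (fun i => x i - x (i - 1)) < 1 := by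
    obtain ⟨i, hi, him⟩ := exists_eq_minOver hN1 (fun i => x i - x (i - 1))
    exact him ▸ hℓ1 i hi
  obtain ⟨hα0, hαlam, -⟩ := critical_exponent hN1 hlam0 hℓ0 hα hm1 hΩ
  obtain ⟨hγ0, hγmu, hγle⟩ := critical_exponent hN1 hmu0 hℓ0 hγ hm1 hΓ
  set τ₁ := Real.log (maxOver N (fun i => |α i|)) /
    Real.log (minOver N (fun i => x i - x (i - 1)))
  set τ₂ := Real.log (maxOver N (fun i => |γ i|)) /
    Real.log (minOver N (fun i => x i - x (i - 1)))
  have hδ0 : 0 < min τ₁ τ₂ := lt_min hα0 hγ0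
  obtain ⟨Mq, -, hMq⟩ := exists_uniform_holder hfin hmu0.le (fun i hi => minOver_le hi mu) hq
  obtain ⟨A, hA, hmaj₂⟩ := eventually_majorant_of_le (M := Mq) hfin hγ0 hγmu
    (fun i hi => ⟨hℓ0 i hi, hℓ1 i hi⟩) hγle
  obtain ⟨C₂, hC₂, hf₂⟩ := exists_holder_of_selfAffine hN hx0 hxN hxmono hγmu.le hγ0 hA hmaj₂
    hMq hf₂c heq₂
  obtain ⟨Mp, hMp0, hMp⟩ := exists_uniform_holder hfin hδ0.le
    (fun i hi => ((min_le_left _ _).trans hαlam.le).trans (minOver_le hi lam)) hp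
  have hαδ : ∀ i ∈ Set.Icc 1 N, |α i| < (x i - x (i - 1)) ^ min τ₁ τ₂ := by
    intro i hi
    have h1 := (le_maxOver hi (fun i => |α i| / (x i - x (i - 1)) ^ minOver N mu)).trans_lt hΘ
    rw [div_lt_one (Real.rpow_pos_of_pos (hℓ0 i hi) _)] at h1
    exact h1.trans_le (Real.rpow_le_rpow_of_exponent_ge (hℓ0 i hi) (hℓ1 i hi).le
      ((min_le_right _ _).trans hγmu.le))
  refine exists_holder_of_selfAffine hN hx0 hxN hxmono le_rfl hδ0 le_rfl
    (eventually_majorant_of_lt hfin hℓ0 hαδ) (h := fun i t => β i * f₂ t + p i t) (M := C₂ + Mp)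
    (fun i hi s hs t ht => ?_) hf₁c (fun i hi t ht => (heq₁ i hi t ht).trans (add_assoc _ _ _))
  have hst : |s - t| ≤ 1 := by
    rw [abs_le]
    constructor <;> linarith [hs.1, hs.2, ht.1, ht.2]
  have hβ : |β i| ≤ 1 := by linarith [hβγ i hi, abs_nonneg (γ i)]
  calc |β i * f₂ s + p i s - (β i * f₂ t + p i t)|
      = |β i * (f₂ s - f₂ t) + (p i s - p i t)| := by ring_nf
    _ ≤ |β i| * |f₂ s - f₂ t| + |p i s - p i t| := by
      rw [← abs_mul]
      exact abs_add_le _ _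
    _ ≤ 1 * (C₂ * |s - t| ^ min τ₁ τ₂) + Mp * |s - t| ^ min τ₁ τ₂ := by
      refine add_le_add (mul_le_mul hβ ((hf₂ s hs t ht).trans ?_) (abs_nonneg _) zero_le_one)
        (hMp i hi s hs t ht)
      exact mul_le_mul_of_nonneg_left (Real.rpow_le_rpow_of_exponent_ge' (abs_nonneg _) hst hδ0.le
        (min_le_right _ _)) hC₂.le
    _ = (C₂ + Mp) * |s - t| ^ min τ₁ τ₂ := by ring
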